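/- arXiv:2603.28165 — 4 statements merged into one kernel-verified Lean document; each statement's English description precedes it below -/
import Mathlib

section
/- Let T be a completely regular Hausdorff space. If Spec C(T) is a PC-space, then no sequence (x_n) of pairwise distinct points of T converges to a point of T. In particular, every metrizable subspace of T is discrete. -/
open Set Topology

namespace PCF

variable {X : Type*}

/-- The compact open subsets of a topological space. -/
def qcop (t : TopologicalSpace X) : Set (Set X) :=
  {U | @IsOpen X t U ∧ @IsCompact X t U}

/-- The complements of the compact open subsets. -/
def qccl (t : TopologicalSpace X) : Set (Set X) :=
  {C | ∃ U ∈ qcop t, C = Uᶜ}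

/-- The Boolean algebra of subsets generated by the compact open sets:
the constructible sets. -/
def Constructible (t : TopologicalSpace X) : Set (Set X) :=
  ⋂₀ {B : Set (Set X) | qcop t ⊆ B ∧ (∀ s ∈ B, sᶜ ∈ B) ∧
        (∀ s ∈ B, ∀ u ∈ B, s ∪ u ∈ B) ∧ (∅ : Set X) ∈ B}

/-- The patch topology: generated by the compact open sets together with their
complements (equivalently, by the constructible sets). -/
def patchTop (t : TopologicalSpace X) : TopologicalSpace X :=
  TopologicalSpace.generateFrom (qcop t ∪ qccl t)

/-- The inverse topology, with the complements of compact opens as a basis of opens. -/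
def invTop (t : TopologicalSpace X) : TopologicalSpace X :=
  TopologicalSpace.generateFrom (qccl t)

/-- The specialization order: `x ≤ y` iff `y` is in the closure of `{x}`. -/
def specLE (t : TopologicalSpace X) (x y : X) : Prop := y ∈ @closure X t {x}

/-- Minimal points for the specialization order. -/
def minPts (t : TopologicalSpace X) : Set X := {x | ∀ y, specLE t y x → y = x}

/-- Maximal points for the specialization order. -/
def maxPts (t : TopologicalSpace X) : Set X := {x | ∀ y, specLE t x y → y = x}

/-- Minimal points of a subset `S`, for the induced specialization order. -/
def minPtsIn (t : TopologicalSpace X) (S : Set X) : Set X :=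
  {x | x ∈ S ∧ ∀ y ∈ S, specLE t y x → y = x}

/-- Maximal points of a subset `S`, for the induced specialization order. -/
def maxPtsIn (t : TopologicalSpace X) (S : Set X) : Set X :=
  {x | x ∈ S ∧ ∀ y ∈ S, specLE t x y → y = x}

/-- The down-set (set of generalizations) generated by `S`. -/
def downset (t : TopologicalSpace X) (S : Set X) : Set X :=
  {x | ∃ s ∈ S, specLE t x s}

/-- The up-set (set of specializations) generated by `S`. -/
def upset (t : TopologicalSpace X) (S : Set X) : Set X :=
  {x | ∃ s ∈ S, specLE t s x}

/-- A topology is spectral if the space is compact, sober (quasi-sober and T0),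
the compact opens form a basis, and the compact opens are closed under
finite intersections. -/
def IsSpectral (t : TopologicalSpace X) : Prop :=
  @CompactSpace X t ∧ @QuasiSober X t ∧ @T0Space X t ∧
  @TopologicalSpace.IsTopologicalBasis X t (qcop t) ∧
  ∀ U ∈ qcop t, ∀ V ∈ qcop t, U ∩ V ∈ qcop t

/-- A Boolean space: compact, Hausdorff and zero-dimensional. -/
def IsBooleanSpace (t : TopologicalSpace X) : Prop :=
  @CompactSpace X t ∧ @T2Space X t ∧
  @TopologicalSpace.IsTopologicalBasis X t {U | @IsClopen X t U}

/-- `V` is the pseudocomplement of `U` in the lattice of sets `L` (ordered by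
inclusion, with meet given by intersection and bottom element `∅`): `V` is the
largest element of `L` disjoint from `U`. -/
def IsPseudoCompl (L : Set (Set X)) (U V : Set X) : Prop :=
  V ∈ L ∧ U ∩ V = ∅ ∧ ∀ W ∈ L, U ∩ W = ∅ → W ⊆ V

/-- The lattice of sets `L` is pseudocomplemented: every element has a
pseudocomplement. -/
def Pseudocomplemented (L : Set (Set X)) : Prop :=
  ∀ U ∈ L, ∃ V, IsPseudoCompl L U V

/-- The lattice of sets `L` is a Stone algebra: it is pseudocomplemented and
`U* ∪ U** = ⊤` for every `U`. -/
def StoneAlgebra (L : Set (Set X)) : Prop :=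
  Pseudocomplemented L ∧
  ∀ U ∈ L, ∀ V W : Set X, IsPseudoCompl L U V → IsPseudoCompl L V W → V ∪ W = univ

/-- The lattice of sets `L` is a Heyting algebra: for all `U, V ∈ L` there is a
largest `W ∈ L` with `U ∩ W ⊆ V`. -/
def HeytingAlg (L : Set (Set X)) : Prop :=
  ∀ U ∈ L, ∀ V ∈ L, ∃ W ∈ L, U ∩ W ⊆ V ∧ ∀ W' ∈ L, U ∩ W' ⊆ V → W' ⊆ W

/-- A PC-space: the lattice of compact open sets is pseudocomplemented. -/
def IsPCSpace (t : TopologicalSpace X) : Prop := Pseudocomplemented (qcop t)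

/-- An Esakia space: the closure of every constructible set is constructible. -/
def IsEsakia (t : TopologicalSpace X) : Prop :=
  ∀ S ∈ Constructible t, @closure X t S ∈ Constructible t

/-- A spectral root system: the closure of every point is a specialization chain. -/
def IsRootSystem (t : TopologicalSpace X) : Prop :=
  ∀ x : X, IsChain (specLE t) (@closure X t {x})

/-- A spectral forest: the inverse space is a spectral root system. -/
def IsForest (t : TopologicalSpace X) : Prop := IsRootSystem (invTop t)

/-- A stranded space: the specialization poset is a disjoint union of chains, i.e.
the set of points comparable with any fixed point is a chain. -/
def Stranded (t : TopologicalSpace X) : Prop :=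
  ∀ x : X, IsChain (specLE t) {y | specLE t x y ∨ specLE t y x}

end PCF

open PCF

section Rings

variable (T : Type*) [TopologicalSpace T]

/-- The zero set of a continuous real-valued function. -/
def zeroSet (f : ContinuousMap T ℝ) : Set T := {t | f t = 0}

/-- The lattice of cozero sets of a topological space. -/
def Coz : Set (Set T) := {U | ∃ f : ContinuousMap T ℝ, U = {t | f t ≠ 0}}

/-- A z-ideal of the ring `C(T)` of continuous real-valued functions. -/
def IsZIdeal (I : Ideal (ContinuousMap T ℝ)) : Prop :=
  ∀ f ∈ I, ∀ g : ContinuousMap T ℝ, zeroSet T f ⊆ zeroSet T g → g ∈ I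

/-- The prime z-ideals, as a subset of the prime spectrum of `C(T)`. -/
def zSpec : Set (PrimeSpectrum (ContinuousMap T ℝ)) :=
  {p | IsZIdeal T p.asIdeal}

/-- A space is basically disconnected if the closure of every cozero set is open. -/
def BasicallyDisconnected : Prop :=
  ∀ f : ContinuousMap T ℝ, IsOpen (closure {t | f t ≠ 0})

/-- The Zariski topology on the prime spectrum of `C(T)`. -/
def specTop : TopologicalSpace (PrimeSpectrum (ContinuousMap T ℝ)) := inferInstance

/-- The subspace topology on the set of prime z-ideals. -/
def zTop : TopologicalSpace ↥(zSpec T) := inferInstance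

end Rings

/-- The subspace topology on a subset. -/
def subTop {Y : Type*} [TopologicalSpace Y] (X : Set Y) : TopologicalSpace ↥X :=
  inferInstance

/-- A gauge tending to `0` at `0` more slowly than every positive power. -/
noncomputable def logGauge (t : ℝ) : ℝ := if t = 0 then 0 else (Real.log (|t|⁻¹ + 2))⁻¹

lemma log_abs_inv_add_two_pos (t : ℝ) : 0 < Real.log (|t|⁻¹ + 2) :=
  Real.log_pos (by have := inv_nonneg.2 (abs_nonneg t); linarith)

lemma logGauge_zero : logGauge 0 = 0 := if_pos rfl

lemma logGauge_of_ne {t : ℝ} (ht : t ≠ 0) : logGauge t = (Real.log (|t|⁻¹ + 2))⁻¹ := if_neg ht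

lemma tendsto_abs_inv_add_two :
    Filter.Tendsto (fun t : ℝ => |t|⁻¹ + 2) (𝓝[≠] 0) Filter.atTop :=
  Filter.tendsto_atTop_add_const_right _ _
    (Filter.Tendsto.inv_tendsto_nhdsGT_zero tendsto_abs_nhdsNE_zero)

lemma continuous_logGauge : Continuous logGauge := by
  rw [continuous_iff_continuousAt]
  intro t
  by_cases ht : t = 0
  · subst ht
    rw [continuousAt_iff_punctured_nhds, logGauge_zero]
    refine ((Real.tendsto_log_atTop.comp tendsto_abs_inv_add_two).inv_tendsto_atTop).congr' ?_
    filter_upwards [self_mem_nhdsWithin] with s hs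
    exact (logGauge_of_ne hs).symm
  · have hc : ContinuousAt (fun s : ℝ => (Real.log (|s|⁻¹ + 2))⁻¹) t := by
      refine ContinuousAt.inv₀ (ContinuousAt.log ?_ ?_) (log_abs_inv_add_two_pos t).ne'
      · exact (continuous_abs.continuousAt.inv₀ (abs_ne_zero.2 ht)).add continuousAt_const
      · positivity
    refine hc.congr ?_
    filter_upwards [isOpen_ne.mem_nhds ht] with s hs
    exact (logGauge_of_ne hs).symm

/-- Every positive power of `logGauge` dominates the identity near `0`. -/
lemma tendsto_div_logGauge_pow (n : ℕ) :
    Filter.Tendsto (fun t : ℝ => |t| / logGauge t ^ n) (𝓝[≠] 0) (𝓝 0) := by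
  refine ((Real.tendsto_pow_log_div_mul_add_atTop 1 (-2) n one_ne_zero).comp
    tendsto_abs_inv_add_two).congr' ?_
  filter_upwards [self_mem_nhdsWithin] with t ht
  simp [logGauge_of_ne ht, div_eq_mul_inv, mul_comm]

/-- In a reduced ring whose spectrum is a PC-space, the annihilator of an element is the radical
of a finitely generated ideal. -/
lemma exists_finset_mem_radical_span_iff {R : Type*} [CommRing R] [IsReduced R]
    (hPC : IsPCSpace (inferInstance : TopologicalSpace (PrimeSpectrum R))) (f : R) :
    ∃ s : Finset R, ∀ h : R, h ∈ (Ideal.span (s : Set R)).radical ↔ f * h = 0 := by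
  have key (h : R) : ((PrimeSpectrum.basicOpen f : Set (PrimeSpectrum R)) ∩
      PrimeSpectrum.basicOpen h = ∅) ↔ f * h = 0 := by
    rw [← isNilpotent_iff_eq_zero, ← PrimeSpectrum.basicOpen_eq_bot_iff,
      PrimeSpectrum.basicOpen_mul, ← TopologicalSpace.Opens.coe_inj]
    simp
  have hmem (h : R) : (PrimeSpectrum.basicOpen h : Set (PrimeSpectrum R)) ∈
      qcop (inferInstance : TopologicalSpace (PrimeSpectrum R)) :=
    ⟨(PrimeSpectrum.basicOpen h).isOpen, PrimeSpectrum.isCompact_basicOpen h⟩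
  obtain ⟨V, hV, hfV, hmax⟩ := hPC _ (hmem f)
  obtain ⟨s, rfl⟩ := PrimeSpectrum.isCompact_isOpen_iff.1 ⟨hV.2, hV.1⟩
  refine ⟨s, fun h => ?_⟩
  have hrad : h ∈ (Ideal.span (s : Set R)).radical ↔
      (PrimeSpectrum.basicOpen h : Set (PrimeSpectrum R)) ⊆ (PrimeSpectrum.zeroLocus s)ᶜ := by
    rw [← PrimeSpectrum.vanishingIdeal_zeroLocus_eq_radical, PrimeSpectrum.zeroLocus_span,
      PrimeSpectrum.basicOpen_eq_zeroLocus_compl, Set.compl_subset_compl,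
      PrimeSpectrum.mem_vanishingIdeal]
    simp [Set.subset_def, PrimeSpectrum.mem_zeroLocus]
  rw [hrad, ← key]
  refine ⟨fun hsub => ?_, hmax _ (hmem h)⟩
  exact Set.subset_empty_iff.1 (hfV ▸ Set.inter_subset_inter_right _ hsub)

/-- A member of a finitely generated ideal of `C(T)` is bounded by a continuous multiple of the
sum of the absolute values of the generators. -/
lemma exists_abs_le_of_mem_span {T : Type*} [TopologicalSpace T] {s : Finset (ContinuousMap T ℝ)}
    {h : ContinuousMap T ℝ} (hh : h ∈ Ideal.span (s : Set (ContinuousMap T ℝ))) :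
    ∃ K : ContinuousMap T ℝ, ∀ t, |h t| ≤ K t * ∑ g ∈ s, |g t| := by
  obtain ⟨c, -, rfl⟩ := Submodule.mem_span_finset.1 hh
  refine ⟨∑ g ∈ s, |c g|, fun t => ?_⟩
  simp only [ContinuousMap.sum_apply, ContinuousMap.abs_apply, smul_eq_mul,
    ContinuousMap.mul_apply]
  refine (Finset.abs_sum_le_sum_abs _ _).trans ?_
  rw [Finset.mul_sum]
  refine Finset.sum_le_sum fun g hg => ?_
  rw [abs_mul]
  exact mul_le_mul_of_nonneg_right
    (Finset.single_le_sum (f := fun g => |c g t|) (fun _ _ => abs_nonneg _) hg) (abs_nonneg _)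

/-- Prescribed convergent values along an injective sequence converging to a point outside its
range extend to a continuous function. -/
lemma exists_continuousMap_eq_on_seq {T : Type*} [TopologicalSpace T] [CompletelyRegularSpace T]
    [T2Space T] {x : ℕ → T} {a : T} (hinj : Function.Injective x) (ha : ∀ n, x n ≠ a)
    (hx : Filter.Tendsto x Filter.atTop (𝓝 a)) {v : ℕ → ℝ} {l : ℝ}
    (hv : Filter.Tendsto v Filter.atTop (𝓝 l)) :
    ∃ F : ContinuousMap T ℝ, ∀ n, F (x n) = v n := by
  have : T35Space T := {}
  have hemb := (isDenseEmbedding_stoneCechUnit (X := T)).isEmbedding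
  let e : ContinuousMap (OnePoint ℕ) (StoneCech T) :=
    (⟨stoneCechUnit, hemb.continuous⟩ : ContinuousMap T (StoneCech T)).comp
      (OnePoint.continuousMapMkNat x a hx)
  have he : IsClosedEmbedding e := by
    refine e.continuous.isClosedEmbedding (hemb.injective.comp ?_)
    intro p q hpq
    induction p using OnePoint.rec with
    | infty =>
      induction q using OnePoint.rec with
      | infty => rfl
      | coe n => exact absurd hpq.symm (ha n)
    | coe m =>
      induction q using OnePoint.rec with
      | infty => exact absurd hpq (ha m)
      | coe n => exact congrArg _ (hinj hpq)
  obtain ⟨g, hg⟩ := ContinuousMap.exists_extension he (OnePoint.continuousMapMkNat v l hv)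
  exact ⟨g.comp ⟨stoneCechUnit, hemb.continuous⟩, fun n => DFunLike.congr_fun hg (n : OnePoint ℕ)⟩

lemma not_tendsto_of_isPCSpace {T : Type*} [TopologicalSpace T] [CompletelyRegularSpace T]
    [T2Space T] (hPC : IsPCSpace (specTop T)) {x : ℕ → T} {a : T}
    (hinj : Function.Injective x) (ha : ∀ n, x n ≠ a) :
    ¬ Filter.Tendsto x Filter.atTop (𝓝 a) := by
  intro hx
  have hv : Filter.Tendsto (fun n : ℕ => (-1 : ℝ) ^ n / (n + 1)) Filter.atTop (𝓝 0) := by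
    refine squeeze_zero_norm (fun n => ?_) tendsto_one_div_add_atTop_nhds_zero_nat
    rw [norm_div, norm_pow, norm_neg, norm_one, one_pow, Real.norm_of_nonneg (by positivity)]
  obtain ⟨F, hF⟩ := exists_continuousMap_eq_on_seq hinj ha hx hv
  have hFeven (j : ℕ) : 0 < F (x (2 * j)) := by
    rw [hF, pow_mul, neg_one_sq, one_pow]; positivity
  have hFodd (j : ℕ) : F (x (2 * j + 1)) < 0 := by
    rw [hF, pow_succ, pow_mul, neg_one_sq, one_pow, one_mul]
    exact div_neg_of_neg_of_pos (by norm_num) (by positivity)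
  have : IsReduced (ContinuousMap T ℝ) := ⟨fun f ⟨n, hn⟩ => by
    ext t
    exact eq_zero_of_pow_eq_zero (n := n) (by simpa using DFunLike.congr_fun hn t)⟩
  obtain ⟨s, hs⟩ := exists_finset_mem_radical_span_iff (R := ContinuousMap T ℝ) hPC (F ⊔ 0)
  let G : ContinuousMap T ℝ := ∑ g ∈ s, |g|
  have hG (t : T) : G t = ∑ g ∈ s, |g t| := by simp [G]
  have hGpos {t : T} (ht : 0 < F t) : G t = 0 := by
    rw [hG]
    refine Finset.sum_eq_zero fun g hg => ?_
    have := DFunLike.congr_fun ((hs g).1 (Ideal.le_radical (Ideal.subset_span hg))) t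
    simpa [ht, ht.le, ht.ne'] using this
  have hGa : G a = 0 := by
    have h2 : Filter.Tendsto (fun j => G (x (2 * j))) Filter.atTop (𝓝 (G a)) :=
      (G.continuous.tendsto a).comp (hx.comp
        (Filter.tendsto_id.const_mul_atTop' (by norm_num : 0 < 2)))
    simp only [hGpos (hFeven _)] at h2
    exact tendsto_nhds_unique tendsto_const_nhds h2 |>.symm
  have hGneg {t : T} (ht : F t < 0) : G t ≠ 0 := by
    intro h0
    obtain ⟨n, hn⟩ := (hs ((-F) ⊔ 0)).2 <| by
      ext u
      rcases le_total (F u) 0 with hu | hu <;> simp [hu]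
    obtain ⟨K, hK⟩ := exists_abs_le_of_mem_span hn
    have h1 := hK t
    rw [← hG, h0, mul_zero] at h1
    have h2 : 0 < (((-F) ⊔ 0) ^ n) t := by
      rw [ContinuousMap.pow_apply]
      exact pow_pos (lt_sup_of_lt_left (neg_pos.2 ht)) n
    exact absurd h1 (abs_pos.2 h2.ne').not_ge
  let y : ℕ → T := fun j => x (2 * j + 1)
  have hy : Filter.Tendsto y Filter.atTop (𝓝 a) :=
    hx.comp (Filter.tendsto_atTop_mono (fun j => by simp; omega) Filter.tendsto_id)
  have hGy : Filter.Tendsto (fun j => G (y j)) Filter.atTop (𝓝[≠] 0) :=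
    tendsto_nhdsWithin_iff.2 ⟨hGa ▸ (G.continuous.tendsto a).comp hy,
      Filter.Eventually.of_forall fun j => hGneg (hFodd j)⟩
  obtain ⟨n, hn⟩ := (hs ((⟨logGauge, continuous_logGauge⟩ : ContinuousMap ℝ ℝ).comp G)).2 <| by
    ext u
    rcases le_or_gt (F u) 0 with hu | hu
    · simp [hu]
    · simp [hGpos hu, logGauge_zero]
  obtain ⟨K, hK⟩ := exists_abs_le_of_mem_span hn
  have hlim := ((K.continuous.tendsto a).comp hy).mul ((tendsto_div_logGauge_pow n).comp hGy)
  rw [mul_zero] at hlim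
  refine absurd (ge_of_tendsto' hlim (b := 1) fun j => ?_) (by norm_num)
  have h0 : G (y j) ≠ 0 := hGneg (hFodd j)
  have hpos : 0 < logGauge (G (y j)) := by
    rw [logGauge_of_ne h0]; exact inv_pos.2 (log_abs_inv_add_two_pos _)
  have hGnn : 0 ≤ G (y j) := by rw [hG]; positivity
  have h1 := hK (y j)
  rw [← hG] at h1
  simp only [Function.comp_apply]
  rw [abs_of_nonneg hGnn, ← mul_div_assoc, one_le_div (by positivity)]
  exact (le_abs_self _).trans h1

lemma exists_injective_seq_tendsto {Y : Type*} [TopologicalSpace Y]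
    [TopologicalSpace.MetrizableSpace Y] (a : Y) [(𝓝[≠] a).NeBot] :
    ∃ x : ℕ → Y, Function.Injective x ∧ Filter.Tendsto x Filter.atTop (𝓝 a) := by
  let := TopologicalSpace.metrizableSpaceMetric Y
  obtain ⟨u, hu⟩ := Filter.exists_seq_tendsto (𝓝[≠] a)
  rw [tendsto_nhdsWithin_iff] at hu
  have hd : Filter.Tendsto (fun n => (dist (u n) a)⁻¹) Filter.atTop Filter.atTop := by
    refine Filter.Tendsto.inv_tendsto_nhdsGT_zero (tendsto_nhdsWithin_iff.2
      ⟨tendsto_iff_dist_tendsto_zero.1 hu.1, ?_⟩)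
    filter_upwards [hu.2] with n hn using dist_pos.2 hn
  obtain ⟨φ, hφ, hmono⟩ := Filter.strictMono_subseq_of_tendsto_atTop hd
  exact ⟨u ∘ φ, Function.Injective.of_comp (f := fun p => (dist p a)⁻¹) hmono.injective,
    hu.1.comp hφ.tendsto_atTop⟩

/-- If `T` is completely regular Hausdorff and `Spec C(T)` is a PC-space,
then no sequence of pairwise distinct points of `T` converges in `T`; in particular,
every metrizable subspace of `T` is discrete. -/
theorem statement_16 {T : Type*} [TopologicalSpace T] [CompletelyRegularSpace T]
    [T2Space T] (hPC : IsPCSpace (specTop T)) :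
    (¬ ∃ (x : ℕ → T) (a : T),
        Function.Injective x ∧ Filter.Tendsto x Filter.atTop (nhds a)) ∧
    ∀ S : Set T, TopologicalSpace.MetrizableSpace ↥S → DiscreteTopology ↥S := by
  have hseq : ¬ ∃ (x : ℕ → T) (a : T),
      Function.Injective x ∧ Filter.Tendsto x Filter.atTop (nhds a) := by
    rintro ⟨x, a, hinj, hx⟩
    obtain ⟨N, hN⟩ : ∃ N, ∀ n, x (n + N) ≠ a := by
      by_cases h : ∃ m, x m = a
      · obtain ⟨m, rfl⟩ := h
        exact ⟨m + 1, fun n hn => by have := hinj hn; omega⟩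
      · exact ⟨0, fun n hn => h ⟨_, hn⟩⟩
    exact not_tendsto_of_isPCSpace hPC (hinj.comp (add_left_injective N)) hN
      (hx.comp (Filter.tendsto_add_atTop_nat N))
  refine ⟨hseq, fun S hS => ?_⟩
  rw [discreteTopology_iff_nhds_ne]
  intro a
  by_contra hne
  have : (𝓝[≠] a).NeBot := ⟨hne⟩
  obtain ⟨x, hinj, hx⟩ := exists_injective_seq_tendsto a
  exact hseq ⟨fun n => x n, a, Subtype.val_injective.comp hinj,
    (continuous_subtype_val.tendsto a).comp hx⟩
end

section
/- Let T be a metrizable topological space. Then the following are equivalent: (i) Spec C(T) is a PC-space; (ii) Spec C(T) is an Esakia space; (iii) T is discrete. -/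
open Set Topology

open PCF

open Filter

section PrimeSpectrum

variable {R : Type*} [CommRing R]

lemma isConstructible_of_mem_constructible {S : Set (PrimeSpectrum R)}
    (hS : S ∈ PCF.Constructible (inferInstance : TopologicalSpace (PrimeSpectrum R))) :
    IsConstructible S :=
  hS {S | IsConstructible S}
    ⟨fun _ hU => hU.2.isConstructible hU.1, fun _ hs => isConstructible_compl.2 hs,
      fun _ hs _ hu => hs.union hu, .empty⟩

lemma qcop_subset_constructible {X : Type*} (t : TopologicalSpace X) :
    qcop t ⊆ PCF.Constructible t :=
  fun _ hU _ hB => hB.1 hU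

lemma isCompact_of_isConstructible {S : Set (PrimeSpectrum R)} (hS : IsConstructible S) :
    IsCompact S := by
  obtain ⟨A, _, φ, rfl⟩ := PrimeSpectrum.exists_range_eq_of_isConstructible hS
  exact isCompact_range (PrimeSpectrum.continuous_comap φ)

lemma isPCSpace_of_isEsakia
    (h : IsEsakia (inferInstance : TopologicalSpace (PrimeSpectrum R))) :
    IsPCSpace (inferInstance : TopologicalSpace (PrimeSpectrum R)) := by
  intro U hU
  refine ⟨(closure U)ᶜ, ⟨isClosed_closure.isOpen_compl, ?_⟩, ?_, ?_⟩
  · exact isCompact_of_isConstructible (isConstructible_compl.2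
      (isConstructible_of_mem_constructible (h U (qcop_subset_constructible _ hU))))
  · exact (disjoint_compl_right_iff_subset.2 subset_closure).inter_eq
  · intro W hW hUW
    rw [subset_compl_comm]
    exact closure_minimal (disjoint_iff_inter_eq_empty.2 hUW).subset_compl_right
      hW.1.isClosed_compl

lemma isEsakia_of_forall_isClosed {X : Type*} (t : TopologicalSpace X)
    (h : ∀ U ∈ qcop t, IsClosed U) : IsEsakia t := by
  intro S hS
  have : IsClopen S := hS {S | IsClopen S}
    ⟨fun U hU => ⟨h U hU, hU.1⟩, fun _ hs => hs.compl, fun _ hs _ hu => hs.union hu,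
      isClopen_empty⟩
  rwa [this.1.closure_eq]

end PrimeSpectrum

section ContinuousFunctions

variable {T : Type*} [TopologicalSpace T]

lemma isOpen_zeroLocus_singleton_of_discreteTopology [DiscreteTopology T] (g : C(T, ℝ)) :
    IsOpen (PrimeSpectrum.zeroLocus {g}) := by
  let i : C(T, ℝ) := ⟨fun x => (g x)⁻¹, continuous_of_discreteTopology⟩
  have hgig : g * i * g = g := by
    ext x
    exact mul_inv_mul_cancel (g x)
  have hz : PrimeSpectrum.zeroLocus {g} = PrimeSpectrum.zeroLocus {g * i} := by
    ext p
    simp only [PrimeSpectrum.mem_zeroLocus, singleton_subset_iff, SetLike.mem_coe]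
    refine ⟨fun h => p.asIdeal.mul_mem_right i h, fun h => ?_⟩
    rw [← hgig]
    exact p.asIdeal.mul_mem_right g h
  rw [hz, ← PrimeSpectrum.basicOpen_eq_zeroLocus_of_mul_add (1 - g * i) (g * i)
    (by rw [sub_mul, one_mul, ← mul_assoc, hgig, sub_self]) (sub_add_cancel _ _)]
  exact (PrimeSpectrum.basicOpen _).isOpen

lemma isEsakia_of_discreteTopology [DiscreteTopology T] : IsEsakia (specTop T) := by
  refine isEsakia_of_forall_isClosed (X := PrimeSpectrum C(T, ℝ)) _ fun U hU => ?_
  obtain ⟨s, rfl⟩ := PrimeSpectrum.isCompact_isOpen_iff.1 hU.symm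
  rw [isClosed_compl_iff, ← biUnion_of_singleton (s : Set C(T, ℝ)),
    PrimeSpectrum.zeroLocus_iUnion₂]
  exact isOpen_biInter_finset fun g _ => isOpen_zeroLocus_singleton_of_discreteTopology g

/-- In a ring of continuous functions, a pseudocomplement of a basic open set yields finitely many
functions generating the annihilator up to radical. -/
lemma exists_finset_of_isPCSpace (h : IsPCSpace (specTop T)) (f : C(T, ℝ)) :
    ∃ s : Finset C(T, ℝ), (∀ g ∈ s, f * g = 0) ∧
      ∀ k : C(T, ℝ), f * k = 0 → ∃ n : ℕ, k ^ n ∈ Ideal.span (s : Set C(T, ℝ)) := by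
  have : IsReduced C(T, ℝ) := ⟨fun a ⟨n, hn⟩ => ContinuousMap.ext fun x =>
    eq_zero_of_pow_eq_zero (DFunLike.congr_fun hn x)⟩
  have disj : ∀ a b : C(T, ℝ), (PrimeSpectrum.basicOpen a : Set (PrimeSpectrum C(T, ℝ))) ∩
      PrimeSpectrum.basicOpen b = ∅ ↔ a * b = 0 := by
    intro a b
    rw [← TopologicalSpace.Opens.coe_inf, ← PrimeSpectrum.basicOpen_mul,
      TopologicalSpace.Opens.coe_eq_empty, PrimeSpectrum.basicOpen_eq_bot_iff,
      isNilpotent_iff_eq_zero]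
  obtain ⟨V, hV, hfV, hmax⟩ := h (PrimeSpectrum.basicOpen f)
    ⟨(PrimeSpectrum.basicOpen f).isOpen, PrimeSpectrum.isCompact_basicOpen f⟩
  obtain ⟨s, rfl⟩ := PrimeSpectrum.isCompact_isOpen_iff.1 hV.symm
  refine ⟨s, fun g hg => (disj f g).1 ?_, fun k hk => ?_⟩
  · refine subset_empty_iff.1 (subset_trans (inter_subset_inter_right _ ?_) hfV.subset)
    rw [PrimeSpectrum.basicOpen_eq_zeroLocus_compl, compl_subset_compl]
    exact PrimeSpectrum.zeroLocus_anti_mono (singleton_subset_iff.2 hg)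
  · have hsub := hmax (PrimeSpectrum.basicOpen k)
      ⟨(PrimeSpectrum.basicOpen k).isOpen, PrimeSpectrum.isCompact_basicOpen k⟩ ((disj f k).2 hk)
    rw [PrimeSpectrum.basicOpen_eq_zeroLocus_compl, compl_subset_compl,
      ← PrimeSpectrum.zeroLocus_span (s : Set C(T, ℝ)), ← PrimeSpectrum.zeroLocus_span {k},
      PrimeSpectrum.zeroLocus_subset_zeroLocus_iff] at hsub
    exact hsub (Ideal.subset_span rfl)

lemma eventually_abs_le_of_mem_span (s : Finset C(T, ℝ)) {u : C(T, ℝ)}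
    (hu : u ∈ Ideal.span (s : Set C(T, ℝ))) (q : T) :
    ∃ C : ℝ, ∀ᶠ x in 𝓝 q, |u x| ≤ C * ∑ g ∈ s, |g x| := by
  have hG : ∀ x, 0 ≤ ∑ g ∈ s, |g x| := fun x => Finset.sum_nonneg fun g _ => abs_nonneg _
  induction hu using Submodule.span_induction with
  | mem g hg =>
    refine ⟨1, Eventually.of_forall fun x => ?_⟩
    rw [one_mul]
    exact Finset.single_le_sum (f := fun g : C(T, ℝ) => |g x|) (fun g _ => abs_nonneg _) hg
  | zero => exact ⟨0, Eventually.of_forall fun x => by simp⟩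
  | add a b _ _ ha hb =>
    obtain ⟨A, hA⟩ := ha
    obtain ⟨B, hB⟩ := hb
    refine ⟨A + B, ?_⟩
    filter_upwards [hA, hB] with x hxA hxB
    rw [add_mul]
    exact (abs_add_le _ _).trans (add_le_add hxA hxB)
  | smul a b _ hb =>
    obtain ⟨B, hB⟩ := hb
    refine ⟨(|a q| + 1) * B, ?_⟩
    have ha : ∀ᶠ x in 𝓝 q, |a x| < |a q| + 1 :=
      (a.continuous.abs.tendsto q).eventually_lt_const (lt_add_one _)
    filter_upwards [hB, ha] with x hxB hxa
    rw [smul_eq_mul, ContinuousMap.mul_apply, abs_mul, mul_assoc]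
    exact mul_le_mul hxa.le hxB (abs_nonneg _) (by positivity)

lemma continuousOn_inv_log : ContinuousOn (fun t : ℝ => (Real.log t)⁻¹) (Ico 0 1) := by
  intro t ht
  rcases eq_or_lt_of_le ht.1 with rfl | h0
  · refine ContinuousAt.continuousWithinAt ?_
    rw [continuousAt_iff_punctured_nhds]
    rw [Real.log_zero, inv_zero]
    exact Real.tendsto_log_nhdsNE_zero.inv_tendsto_atBot
  · exact ((Real.continuousAt_log h0.ne').inv₀
      (Real.log_neg h0 ht.2).ne).continuousWithinAt

/-- A continuous function vanishing exactly on the zero set of `G`, no power of which is locally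
bounded by a multiple of `G` at a boundary point of this zero set. -/
lemma exists_flat (G : C(T, ℝ)) (hG : ∀ x, 0 ≤ G x) :
    ∃ k : C(T, ℝ), (∀ x, k x = 0 ↔ G x = 0) ∧ ∀ (q : T) (n : ℕ) (C : ℝ), G q = 0 →
      (∀ᶠ x in 𝓝 q, |k x ^ n| ≤ C * G x) → ∀ᶠ x in 𝓝 q, G x = 0 := by
  have hpos : ∀ x, 0 < 1 + G x := fun x => by linarith [hG x]
  let c : C(T, ℝ) := ⟨fun x => G x / (1 + G x),
    G.continuous.div (by fun_prop) fun x => (hpos x).ne'⟩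
  have hc : ∀ x, c x ∈ Ico (0 : ℝ) 1 := fun x =>
    ⟨div_nonneg (hG x) (hpos x).le, (div_lt_one (hpos x)).2 (by linarith)⟩
  have hGc : ∀ x, G x = (1 + G x) * c x := fun x =>
    (mul_div_cancel₀ _ (hpos x).ne').symm
  have hc0 : ∀ x, c x = 0 ↔ G x = 0 := fun x => by
    rw [hGc x, mul_eq_zero, or_iff_right (hpos x).ne']
  have hlog : ∀ x, c x ≠ 0 → Real.log (c x) < 0 := fun x hx =>
    Real.log_neg (lt_of_le_of_ne (hc x).1 hx.symm) (hc x).2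
  refine ⟨⟨fun x => (Real.log (c x))⁻¹, continuousOn_inv_log.comp_continuous c.continuous hc⟩,
    fun x => ?_, fun q n C hq hb => ?_⟩
  · rw [← hc0]
    refine ⟨fun h => by_contra fun h0 => (inv_ne_zero (hlog x h0).ne) h, fun h => ?_⟩
    simp [h]
  · have hlim : ∀ᶠ t in 𝓝[>] (0 : ℝ), 2 * |C| * (t * |Real.log t| ^ n) < 1 := by
      have h1 := (isLittleO_abs_log_rpow_rpow_nhdsGT_zero n
        (show (-1 : ℝ) < 0 by norm_num)).tendsto_div_nhds_zero
      have h2 := h1.const_mul (2 * |C|)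
      rw [mul_zero] at h2
      filter_upwards [h2.eventually_lt_const one_pos, self_mem_nhdsWithin] with t ht ht0
      rw [Real.rpow_natCast, Real.rpow_neg_one, div_inv_eq_mul, mul_comm (_ ^ n)] at ht
      exact ht
    rw [eventually_nhdsWithin_iff] at hlim
    have hcq : Tendsto c (𝓝 q) (𝓝 0) := by
      simpa [(hc0 q).2 hq] using c.continuous.tendsto q
    have hG1 : ∀ᶠ x in 𝓝 q, G x < 1 :=
      (G.continuous.tendsto q).eventually_lt_const (by rw [hq]; exact one_pos)
    filter_upwards [hb, hcq.eventually hlim, hG1] with x hx hxl hx1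
    by_contra h0
    have hcx : c x ≠ 0 := fun h => h0 ((hc0 x).1 h)
    have hcpos : 0 < c x := lt_of_le_of_ne (hc x).1 hcx.symm
    have hL : 0 < |Real.log (c x)| ^ n := pow_pos (abs_pos.2 (hlog x hcx).ne) n
    have h3 : (|Real.log (c x)| ^ n)⁻¹ ≤ |C| * (2 * c x) := by
      calc (|Real.log (c x)| ^ n)⁻¹ = |((Real.log (c x))⁻¹) ^ n| := by
            rw [abs_pow, abs_inv, inv_pow]
        _ ≤ C * G x := hx
        _ ≤ |C| * G x := mul_le_mul_of_nonneg_right (le_abs_self C) (hG x)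
        _ ≤ |C| * (2 * c x) := by
            refine mul_le_mul_of_nonneg_left ?_ (abs_nonneg C)
            rw [hGc x]
            exact mul_le_mul_of_nonneg_right (by linarith) hcpos.le
    rw [inv_le_iff_one_le_mul₀ hL] at h3
    have h4 := hxl hcpos
    linarith

/-- If `Spec C(T)` is a PC-space, then cozero sets that are disjoint have disjoint closures. -/
lemma notMem_closure_of_isPCSpace (h : IsPCSpace (specTop T)) {f k : C(T, ℝ)} (hfk : f * k = 0)
    {p : T} (hf : p ∈ closure {x | f x ≠ 0}) : p ∉ closure {x | k x ≠ 0} := by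
  obtain ⟨s, hs, hgen⟩ := exists_finset_of_isPCSpace h f
  let G : C(T, ℝ) := ⟨fun x => ∑ g ∈ s, |g x|, by fun_prop⟩
  have hG : ∀ x, 0 ≤ G x := fun x => Finset.sum_nonneg fun g _ => abs_nonneg _
  have hfG : ∀ x, f x ≠ 0 → G x = 0 := fun x hx => Finset.sum_eq_zero fun g hg => by
    rw [abs_eq_zero]
    exact (mul_eq_zero.1 (DFunLike.congr_fun (hs g hg) x)).resolve_left hx
  have hGp : G p = 0 :=
    closure_minimal (t := {x | G x = 0}) hfG (isClosed_eq G.continuous continuous_const) hf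
  obtain ⟨u, hu0, hu⟩ := exists_flat G hG
  have hfu : f * u = 0 := by
    ext x
    by_cases hx : f x = 0
    · simp [hx]
    · simp [(hu0 x).2 (hfG x hx)]
  obtain ⟨n, hn⟩ := hgen u hfu
  obtain ⟨C, hC⟩ := eventually_abs_le_of_mem_span s hn p
  have hev : ∀ᶠ x in 𝓝 p, G x = 0 := hu p n C hGp hC
  obtain ⟨m, hm⟩ := hgen k hfk
  rw [mem_closure_iff_frequently, not_frequently]
  filter_upwards [hev] with x hx
  obtain ⟨D, hD⟩ := eventually_abs_le_of_mem_span s hm x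
  have hD' : |(k ^ m) x| ≤ D * G x := hD.self_of_nhds
  rw [hx, mul_zero, abs_nonpos_iff, ContinuousMap.pow_apply] at hD'
  exact not_not.2 (eq_zero_of_pow_eq_zero hD')

end ContinuousFunctions

/-- Around a non-isolated point of a metric space there are two disjoint open sets accumulating
at the point. -/
lemma exists_disjoint_isOpen_mem_closure {T : Type*} [MetricSpace T] {p : T}
    (hp : (𝓝[≠] p).NeBot) :
    ∃ U V : Set T, IsOpen U ∧ IsOpen V ∧ Disjoint U V ∧ p ∉ U ∧ p ∉ V ∧
      p ∈ closure U ∧ p ∈ closure V := by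
  have hex : ∀ ε : ℝ, ∃ x : T, 0 < ε → 0 < dist x p ∧ dist x p < ε / 2 := by
    intro ε
    by_cases hε : 0 < ε
    · have hball : ∀ᶠ x in 𝓝[≠] p, x ∈ Metric.ball p (ε / 2) :=
        mem_nhdsWithin_of_mem_nhds (Metric.ball_mem_nhds p (half_pos hε))
      obtain ⟨x, hx, hxp⟩ := (hball.and self_mem_nhdsWithin).exists
      exact ⟨x, fun _ => ⟨dist_pos.2 hxp, hx⟩⟩
    · exact ⟨p, fun h => absurd h hε⟩
  choose y hy using hex
  let r : ℕ → ℝ := fun n => (fun ε => dist (y ε) p)^[n] 1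
  have hr_succ : ∀ n, r (n + 1) = dist (y (r n)) p := fun n =>
    Function.iterate_succ_apply' _ _ _
  have hr_pos : ∀ n, 0 < r n := by
    intro n
    induction n with
    | zero => exact one_pos
    | succ n ih => rw [hr_succ]; exact (hy _ ih).1
  have hr_half : ∀ n, r (n + 1) < r n / 2 := fun n => by
    rw [hr_succ]; exact (hy _ (hr_pos n)).2
  have hr_anti : StrictAnti r :=
    strictAnti_nat_of_succ_lt fun n => by linarith [hr_half n, hr_pos n]
  have hr_le : ∀ n, r n ≤ (1 / 2) ^ n := by
    intro n
    induction n with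
    | zero => exact le_of_eq (by simp [r])
    | succ n ih => rw [pow_succ]; linarith [hr_half n]
  let A : ℕ → Set T := fun n => {x | 3 / 4 * r n < dist x p ∧ dist x p < 3 / 2 * r n}
  have hA_open : ∀ n, IsOpen (A n) := fun n =>
    isOpen_Ioo.preimage (continuous_id.dist continuous_const)
  have hA_lt : ∀ {m n x}, m < n → x ∈ A m → x ∉ A n := fun {m n x} hmn hm hn => by
    have := hr_anti.antitone (Nat.succ_le_of_lt hmn)
    linarith [hm.1, hn.2, hr_half m]
  have hA_eq : ∀ {m n x}, x ∈ A m → x ∈ A n → m = n := fun {m n x} hm hn =>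
    (lt_trichotomy m n).elim (fun h => absurd hn (hA_lt h hm))
      fun h => h.elim id fun h => absurd hm (hA_lt h hn)
  have hpA : ∀ n, p ∉ A n := fun n hn => by
    have := hn.1
    rw [dist_self] at this
    linarith [hr_pos n]
  have hcl : ∀ i : ℕ → ℕ, (∀ n, n < i n) → p ∈ closure (⋃ n, A (i n)) := by
    intro i hi
    rw [Metric.mem_closure_iff]
    intro ε hε
    obtain ⟨n, hn⟩ := exists_pow_lt_of_lt_one hε (show (1 / 2 : ℝ) < 1 by norm_num)
    obtain ⟨m, hm⟩ := Nat.exists_eq_succ_of_ne_zero (Nat.ne_of_gt (Nat.zero_lt_of_lt (hi n)))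
    have hd : dist (y (r m)) p = r (i n) := by rw [hm, Nat.succ_eq_add_one, hr_succ]
    have hp := hr_pos (i n)
    refine ⟨y (r m), mem_iUnion.2 ⟨n, ?_, ?_⟩, ?_⟩
    · rw [hd]; linarith
    · rw [hd]; linarith
    · rw [dist_comm, hd]
      exact ((hr_anti (hi n)).trans_le (hr_le n)).trans hn
  refine ⟨⋃ n, A (2 * n + 1), ⋃ n, A (2 * n + 2), isOpen_iUnion fun n => hA_open _,
    isOpen_iUnion fun n => hA_open _, ?_, ?_, ?_, hcl _ fun n => by omega,
    hcl _ fun n => by omega⟩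
  · rw [Set.disjoint_left]
    intro x hx hx'
    obtain ⟨m, hm⟩ := mem_iUnion.1 hx
    obtain ⟨n, hn⟩ := mem_iUnion.1 hx'
    have := hA_eq hm hn
    omega
  · simp [hpA]
  · simp [hpA]

lemma exists_continuousMap_ne_zero_eq {T : Type*} [MetricSpace T] {U : Set T} (hU : IsOpen U)
    (hne : Uᶜ.Nonempty) : ∃ f : C(T, ℝ), {x | f x ≠ 0} = U := by
  refine ⟨⟨fun x => Metric.infDist x Uᶜ, Metric.continuous_infDist_pt _⟩, ?_⟩
  ext x
  change Metric.infDist x Uᶜ ≠ 0 ↔ x ∈ U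
  rw [Ne, ← hU.isClosed_compl.mem_iff_infDist_zero hne, mem_compl_iff, not_not]

lemma discreteTopology_of_isPCSpace {T : Type*} [MetricSpace T] (h : IsPCSpace (specTop T)) :
    DiscreteTopology T := by
  rw [discreteTopology_iff_nhds_ne]
  intro p
  by_contra hp
  obtain ⟨U, V, hU, hV, hUV, hpU, hpV, hclU, hclV⟩ :=
    exists_disjoint_isOpen_mem_closure (neBot_iff.2 hp)
  obtain ⟨f, rfl⟩ := exists_continuousMap_ne_zero_eq hU ⟨p, hpU⟩
  obtain ⟨k, rfl⟩ := exists_continuousMap_ne_zero_eq hV ⟨p, hpV⟩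
  refine notMem_closure_of_isPCSpace h ?_ hclU hclV
  ext x
  by_contra hx
  exact Set.disjoint_left.1 hUV (left_ne_zero_of_mul hx) (right_ne_zero_of_mul hx)

/-- For a metrizable space `T`, TFAE: (i) `Spec C(T)` is a PC-space;
(ii) `Spec C(T)` is an Esakia space; (iii) `T` is discrete. -/
theorem statement_17 {T : Type*} [TopologicalSpace T]
    [TopologicalSpace.MetrizableSpace T] :
    List.TFAE
      [ IsPCSpace (specTop T),
        IsEsakia (specTop T),
        DiscreteTopology T ] := by
  let _ := TopologicalSpace.metrizableSpaceMetric T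
  tfae_have 1 → 3 := discreteTopology_of_isPCSpace
  tfae_have 3 → 2 := fun _ => isEsakia_of_discreteTopology
  tfae_have 2 → 1 := isPCSpace_of_isEsakia
  tfae_finish
end

section
/- Let T be a completely regular Hausdorff space and X = Spec C(T). Then T is a P-space if and only if T is basically disconnected and, for every f ∈ C(T), the set ↓V(f) ∩ X^min is open in X^min, where V(f) = {p ∈ X : f ∈ p}, ↓S denotes the set of prime ideals contained in some member of S, and X^min carries the subspace topology. -/
open Set Topology

open PCF

/-- An element of a minimal prime ideal of a reduced ring is annihilated by an element outside
that ideal. -/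
theorem exists_notMem_mul_eq_zero {R : Type*} [CommRing R] [IsReduced R] {p : Ideal R}
    (hp : p ∈ minimalPrimes R) {x : R} (hx : x ∈ p) : ∃ s ∉ p, s * x = 0 := by
  by_contra! hs
  have hp' : p.IsPrime := hp.1.1
  have hdisj : Disjoint ((⊥ : Ideal R) : Set R)
      (p.primeCompl ⊔ Submonoid.powers x : Submonoid R) := by
    refine Set.disjoint_left.mpr fun z hz hzS => ?_
    obtain ⟨s, hsp, _, ⟨n, rfl⟩, rfl⟩ := Submonoid.mem_sup.mp hzS
    have hz : s * x ^ n = 0 := hz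
    refine hs s hsp (eq_zero_of_pow_eq_zero (n := n + 1) ?_)
    linear_combination s ^ n * x * hz
  obtain ⟨q, hq, -, hqS⟩ := Ideal.exists_le_prime_disjoint _ _ hdisj
  have hqp : q ≤ p := fun z hzq => by
    by_contra hzp
    exact Set.disjoint_left.mp hqS hzq (Submonoid.mem_sup_left hzp)
  exact Set.disjoint_left.mp hqS (hp.2 ⟨hq, bot_le⟩ hqp hx)
    (Submonoid.mem_sup_right (Submonoid.mem_powers x))

/-- A nonzero element of a reduced ring lies outside some minimal prime ideal. -/
theorem exists_minimalPrimes_notMem {R : Type*} [CommRing R] [IsReduced R] {x : R}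
    (hx : x ≠ 0) : ∃ p ∈ minimalPrimes R, x ∉ p := by
  by_contra! h
  refine hx ?_
  have : x ∈ sInf (⊥ : Ideal R).minimalPrimes := (Submodule.mem_sInf).mpr h
  rw [Ideal.sInf_minimalPrimes] at this
  exact isNilpotent_iff_eq_zero.mp this

/-- A reduced ring all of whose prime ideals are maximal is von Neumann regular. -/
theorem exists_eq_mul_mul_of_isMaximal {R : Type*} [CommRing R] [IsReduced R]
    (hmax : ∀ p : PrimeSpectrum R, p.asIdeal.IsMaximal) (f : R) : ∃ g, f = f * f * g := by
  have hmin (p : Ideal R) [hp : p.IsPrime] : p ∈ minimalPrimes R :=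
    ⟨⟨hp, bot_le⟩, fun q hq hqp => ((hmax ⟨q, hq.1⟩).eq_of_le hp.ne_top hqp).ge⟩
  let I : Ideal R := Ideal.span {f} ⊔ (Ideal.span {f}).annihilator
  have hI : I = ⊤ := by
    by_contra hI
    obtain ⟨m, hm, hIm⟩ := Ideal.exists_le_maximal I hI
    have hfm : f ∈ m := hIm (Ideal.mem_sup_left (Ideal.mem_span_singleton_self f))
    obtain ⟨s, hs, hsf⟩ := exists_notMem_mul_eq_zero (hmin m) hfm
    exact hs (hIm (Ideal.mem_sup_right ((Submodule.mem_annihilator_span_singleton f s).mpr hsf)))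
  obtain ⟨y, hy, z, hz, h⟩ := Submodule.mem_sup.mp ((Ideal.eq_top_iff_one I).mp hI)
  obtain ⟨g, rfl⟩ := Ideal.mem_span_singleton'.mp hy
  have hz : z * f = 0 := (Submodule.mem_annihilator_span_singleton f z).mp hz
  exact ⟨g, by linear_combination -f * h + hz⟩

/-- In a ring whose elements all satisfy `f ∈ (f ^ 2)`, prime ideals are maximal. -/
theorem isMaximal_of_forall_exists_eq_mul_mul {R : Type*} [CommRing R]
    (hR : ∀ f : R, ∃ g, f = f * f * g) (p : Ideal R) [hp : p.IsPrime] : p.IsMaximal := by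
  refine Ideal.isMaximal_iff.mpr ⟨(Ideal.ne_top_iff_one p).mp hp.ne_top, fun J f hpJ hfp hfJ => ?_⟩
  obtain ⟨g, hg⟩ := hR f
  have h : f * (1 - f * g) ∈ p := by
    have : f * (1 - f * g) = 0 := by linear_combination hg
    exact this ▸ p.zero_mem
  have := J.add_mem (hpJ ((hp.mem_or_mem h).resolve_left hfp)) (J.mul_mem_right g hfJ)
  simpa using this

/-- Let `S` be the set of minimal primes `p` such that `p` and `f` lie in a common proper ideal.
If `S` is open in the minimal spectrum, double annihilators of elements are generated by idempotents,
and `f` is locally invertible wherever it does not vanish, then `f` generates an idempotent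
ideal. -/
theorem exists_eq_mul_mul_of_isOpen_minimalPrimes {R : Type*} [CommRing R] [IsReduced R]
    (hann : ∀ h : R, ∃ e, h * (1 - e) = 0 ∧ ∀ s, s * h = 0 → s * e = 0) (f : R)
    (hloc : ∀ a, f * a ≠ 0 → ∃ h u, h * a ≠ 0 ∧ u * h = 0 ∧ IsCoprime f u)
    (hopen : ∀ p ∈ minimalPrimes R, p ⊔ Ideal.span {f} ≠ ⊤ →
      ∃ h ∉ p, ∀ q ∈ minimalPrimes R, h ∉ q → q ⊔ Ideal.span {f} ≠ ⊤) :
    ∃ g, f = f * f * g := by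
  let A : Ideal R := sInf {p ∈ minimalPrimes R | p ⊔ Ideal.span {f} = ⊤}
  let B : Ideal R := sInf {p ∈ minimalPrimes R | p ⊔ Ideal.span {f} ≠ ⊤}
  have ext_idem {h e : R} (he : ∀ s, s * h = 0 → s * e = 0) {p : Ideal R}
      (hp : p ∈ minimalPrimes R) (hhp : h ∈ p) : e ∈ p := by
    obtain ⟨s, hs, hsh⟩ := exists_notMem_mul_eq_zero hp hhp
    exact (hp.1.1.mem_or_mem (he s hsh ▸ p.zero_mem)).resolve_left hs
  have hAB : A ⊔ B = ⊤ := by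
    by_contra hne
    obtain ⟨m, hm, hABm⟩ := Ideal.exists_le_maximal _ hne
    have hmp := hm.isPrime
    obtain ⟨p, hp, hpm⟩ := Ideal.exists_minimalPrimes_le (bot_le : ⊥ ≤ m)
    obtain ⟨h, hhp, hh⟩ : ∃ h ∉ p, ∀ e, (∀ s, s * h = 0 → s * e = 0) → e ∈ A ⊔ B := by
      by_cases hpf : p ⊔ Ideal.span {f} = ⊤
      · obtain ⟨x, hx, y, hy, hxy⟩ := Submodule.mem_sup.mp ((Ideal.eq_top_iff_one _).mp hpf)
        obtain ⟨h, hhp, hhx⟩ := exists_notMem_mul_eq_zero hp hx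
        refine ⟨h, hhp, fun e he => Ideal.mem_sup_right (Submodule.mem_sInf.mpr ?_)⟩
        rintro q ⟨hq, hqf⟩
        refine ext_idem he hq ?_
        by_contra hhq
        refine hqf ((Ideal.eq_top_iff_one _).mpr (hxy ▸ Submodule.mem_sup.mpr ⟨x, ?_, y, hy, rfl⟩))
        exact (hq.1.1.mem_or_mem (hhx ▸ q.zero_mem)).resolve_left hhq
      · obtain ⟨h, hhp, hh⟩ := hopen p hp hpf
        refine ⟨h, hhp, fun e he => Ideal.mem_sup_left (Submodule.mem_sInf.mpr ?_)⟩
        rintro q ⟨hq, hqf⟩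
        refine ext_idem he hq ?_
        by_contra hhq
        exact hh q hq hhq hqf
    obtain ⟨e, he1, he2⟩ := hann h
    have h1 : 1 - e ∈ p := (hp.1.1.mem_or_mem (he1 ▸ p.zero_mem)).resolve_left hhp
    have := m.add_mem (hpm h1) (hABm (hh e he2))
    exact (Ideal.ne_top_iff_one m).mp hm.ne_top (by simpa using this)
  obtain ⟨a, ha, b, hb, hab⟩ := Submodule.mem_sup.mp ((Ideal.eq_top_iff_one _).mp hAB)
  have hfa : f * a = 0 := by
    by_contra hfa
    obtain ⟨h, u, hha, huh, x, y, hxy⟩ := hloc a hfa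
    obtain ⟨p, hp, hhap⟩ := exists_minimalPrimes_notMem hha
    have hap : a ∉ p := fun h' => hhap (p.mul_mem_left _ h')
    have hhp : h ∉ p := fun h' => hhap (p.mul_mem_right _ h')
    have hup : u ∈ p := (hp.1.1.mem_or_mem (huh ▸ p.zero_mem)).resolve_right hhp
    refine hap (Submodule.mem_sInf.mp ha p ⟨hp, (Ideal.eq_top_iff_one _).mpr ?_⟩)
    rw [← hxy]
    exact add_mem (Ideal.mem_sup_right (Ideal.mul_mem_left _ _ (Ideal.mem_span_singleton_self f)))
      (Ideal.mem_sup_left (p.mul_mem_left _ hup))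
  have htop : Ideal.span {f} ⊔ Ideal.span {a} = ⊤ := by
    by_contra hne
    obtain ⟨m, hm, hIm⟩ := Ideal.exists_le_maximal _ hne
    have hmp := hm.isPrime
    obtain ⟨p, hp, hpm⟩ := Ideal.exists_minimalPrimes_le (bot_le : ⊥ ≤ m)
    have hpf : p ⊔ Ideal.span {f} ≠ ⊤ := fun h =>
      hm.ne_top (top_le_iff.mp (h ▸ sup_le hpm (le_sup_left.trans hIm)))
    have hbm : b ∈ m := hpm (Submodule.mem_sInf.mp hb p ⟨hp, hpf⟩)
    have ham : a ∈ m := hIm (Ideal.mem_sup_right (Ideal.mem_span_singleton_self a))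
    exact (Ideal.ne_top_iff_one m).mp hm.ne_top (hab ▸ m.add_mem ham hbm)
  obtain ⟨y, hy, z, hz, h⟩ := Submodule.mem_sup.mp ((Ideal.eq_top_iff_one _).mp htop)
  obtain ⟨g, rfl⟩ := Ideal.mem_span_singleton'.mp hy
  obtain ⟨k, rfl⟩ := Ideal.mem_span_singleton'.mp hz
  exact ⟨g, by linear_combination -f * h + k * hfa⟩

theorem mem_minPts_iff {T : Type*} [TopologicalSpace T] (p : PrimeSpectrum C(T, ℝ)) :
    p ∈ minPts (specTop T) ↔ p.asIdeal ∈ minimalPrimes C(T, ℝ) := by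
  have hle (x y : PrimeSpectrum C(T, ℝ)) : specLE (specTop T) x y ↔ x.asIdeal ≤ y.asIdeal :=
    (PrimeSpectrum.le_iff_mem_closure x y).symm
  refine ⟨fun h => ⟨⟨p.2, bot_le⟩, fun q hq hqp => ?_⟩, fun h q hqp => ?_⟩
  · exact (congrArg PrimeSpectrum.asIdeal (h ⟨q, hq.1⟩ ((hle _ _).mpr hqp))).ge
  · have hqp := (hle _ _).mp hqp
    exact PrimeSpectrum.ext (le_antisymm hqp (h.2 ⟨q.2, bot_le⟩ hqp))

theorem mem_downset_zeroLocus_iff {T : Type*} [TopologicalSpace T] (f : C(T, ℝ))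
    (p : PrimeSpectrum C(T, ℝ)) :
    p ∈ downset (specTop T) (PrimeSpectrum.zeroLocus {f}) ↔
      p.asIdeal ⊔ Ideal.span {f} ≠ ⊤ := by
  have hle (x y : PrimeSpectrum C(T, ℝ)) : specLE (specTop T) x y ↔ x.asIdeal ≤ y.asIdeal :=
    (PrimeSpectrum.le_iff_mem_closure x y).symm
  constructor
  · rintro ⟨q, hq, hpq⟩ h
    refine q.2.ne_top (top_le_iff.mp (h ▸ sup_le ((hle _ _).mp hpq) ?_))
    exact (Ideal.span_singleton_le_iff_mem _).mpr (by simpa using hq)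
  · intro h
    obtain ⟨m, hm, hpm⟩ := Ideal.exists_le_maximal _ h
    refine ⟨⟨m, hm.isPrime⟩, ?_, (hle _ _).mpr (le_sup_left.trans hpm)⟩
    simpa using hpm (Ideal.mem_sup_right (Ideal.mem_span_singleton_self f))

/-- In a basically disconnected space, the indicator of the closure of a cozero set generates
the double annihilator. -/
theorem BasicallyDisconnected.exists_indicator {T : Type*} [TopologicalSpace T]
    (hT : BasicallyDisconnected T) (h : C(T, ℝ)) :
    ∃ e : C(T, ℝ), h * (1 - e) = 0 ∧ ∀ s, s * h = 0 → s * e = 0 := by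
  have hc : IsClopen (closure {t | h t ≠ 0}) := ⟨isClosed_closure, hT h⟩
  refine ⟨⟨_, hc.continuous_indicator continuous_one⟩, ?_, fun s hs => ?_⟩
  · ext t
    by_cases ht : h t = 0
    · simp [ht]
    · have : t ∈ closure {t | h t ≠ 0} := subset_closure ht
      simp [Set.indicator_of_mem this]
  · have hsub : closure {t | h t ≠ 0} ⊆ {t | s t = 0} := by
      refine closure_minimal (fun t ht => ?_) (isClosed_eq s.continuous continuous_const)
      exact (mul_eq_zero.mp (DFunLike.congr_fun hs t)).resolve_right ht
    ext t
    by_cases ht : t ∈ closure {t | h t ≠ 0}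
    · have : s t = 0 := hsub ht
      simp [this]
    · simp [Set.indicator_of_notMem ht]

/-- A continuous function is invertible on a cozero neighbourhood of each point where it does
not vanish. -/
theorem ContinuousMap.exists_isCoprime_of_mul_ne_zero {T : Type*} [TopologicalSpace T]
    (f a : C(T, ℝ)) (hfa : f * a ≠ 0) :
    ∃ h u : C(T, ℝ), h * a ≠ 0 ∧ u * h = 0 ∧ IsCoprime f u := by
  obtain ⟨t, ht⟩ := DFunLike.ne_iff.mp hfa
  have hft : f t ≠ 0 := left_ne_zero_of_mul ht
  have hat : a t ≠ 0 := right_ne_zero_of_mul ht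
  obtain ⟨ε, hε, hεf⟩ := exists_between (abs_pos.mpr hft)
  let h : C(T, ℝ) := ⟨fun s => max (|f s| - ε) 0, by fun_prop⟩
  let u : C(T, ℝ) := ⟨fun s => max (ε - |f s|) 0, by fun_prop⟩
  refine ⟨h, u, DFunLike.ne_iff.mpr ⟨t, ?_⟩, ?_, ?_⟩
  · have : h t ≠ 0 := (lt_max_of_lt_left (sub_pos.mpr hεf)).ne'
    exact mul_ne_zero this hat
  · ext s
    rcases le_total |f s| ε with hs | hs
    · simp [h, hs]
    · simp [u, hs]
  · have hunit : IsUnit (f * f + u * u) := by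
      refine (ContinuousMap.isUnit_iff_forall_ne_zero _).mpr fun s hs => ?_
      have hs' : f s * f s + u s * u s = 0 := hs
      have hf0 : f s = 0 := by nlinarith [mul_self_nonneg (f s), mul_self_nonneg (u s)]
      have hu0 : u s = 0 := by nlinarith [mul_self_nonneg (f s), mul_self_nonneg (u s)]
      have : u s = ε := by simp [u, hf0, hε.le]
      linarith
    obtain ⟨v, hv⟩ := hunit.exists_right_inv
    exact ⟨f * v, u * v, by linear_combination hv⟩

/-- A completely regular Hausdorff space `T` is a P-space (every prime
ideal of `C(T)` is maximal) iff `T` is basically disconnected and, for every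
`f ∈ C(T)`, the set `↓V(f) ∩ X^min` is open in `X^min`, where `X = Spec C(T)`. -/
theorem statement_18 {T : Type*} [TopologicalSpace T] [CompletelyRegularSpace T]
    [T2Space T] :
    (∀ p : PrimeSpectrum (ContinuousMap T ℝ), p.asIdeal.IsMaximal) ↔
      (BasicallyDisconnected T ∧
        ∀ f : ContinuousMap T ℝ,
          IsOpen ((Subtype.val ⁻¹'
              (downset (specTop T) (PrimeSpectrum.zeroLocus ({f} : Set _)))) :
            Set ↥(minPts (specTop T)))) := by
  have : IsReduced C(T, ℝ) := by
    refine ⟨fun f hf => ?_⟩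
    obtain ⟨n, hn⟩ := hf
    ext t
    exact eq_zero_of_pow_eq_zero (n := n) (DFunLike.congr_fun hn t)
  constructor
  · intro hmax
    have hreg := exists_eq_mul_mul_of_isMaximal hmax
    refine ⟨fun f => ?_, fun f => ?_⟩
    · obtain ⟨g, hg⟩ := hreg f
      have hcoz : {t | f t ≠ 0} = {t | f t * g t = 1} := by
        ext t
        have ht : f t = f t * f t * g t := DFunLike.congr_fun hg t
        refine ⟨fun h => mul_left_cancel₀ h ?_, fun h h0 => by simp [h0] at h⟩
        linear_combination -ht
      have hclosed : IsClosed {t | f t ≠ 0} :=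
        hcoz ▸ isClosed_eq (f.continuous.mul g.continuous) continuous_const
      rw [hclosed.closure_eq]
      exact isOpen_ne_fun f.continuous continuous_const
    · obtain ⟨g, hg⟩ := hreg f
      have heq : downset (specTop T) (PrimeSpectrum.zeroLocus {f}) =
          PrimeSpectrum.basicOpen (1 - f * g) := by
        ext p
        rw [mem_downset_zeroLocus_iff]
        have hfp : f * (1 - f * g) ∈ p.asIdeal := by
          have : f * (1 - f * g) = 0 := by linear_combination hg
          exact this ▸ p.asIdeal.zero_mem
        refine ⟨fun h h1 => h ?_, fun h h1 => ?_⟩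
        · refine (Ideal.eq_top_iff_one _).mpr ?_
          have := add_mem (Ideal.mem_sup_left h1)
            (Ideal.mem_sup_right (Ideal.mul_mem_right g _ (Ideal.mem_span_singleton_self f)))
          simpa using this
        · have hf : f ∈ p.asIdeal := (p.2.mem_or_mem hfp).resolve_right h
          rw [sup_eq_left.mpr ((Ideal.span_singleton_le_iff_mem _).mpr hf)] at h1
          exact p.2.ne_top h1
      rw [heq]
      exact (PrimeSpectrum.basicOpen _).isOpen.preimage continuous_subtype_val
  · rintro ⟨hT, hopen⟩ p
    have := p.2
    refine isMaximal_of_forall_exists_eq_mul_mul (fun f => ?_) p.asIdeal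
    refine exists_eq_mul_mul_of_isOpen_minimalPrimes hT.exists_indicator f
      (ContinuousMap.exists_isCoprime_of_mul_ne_zero f) fun p hp hpf => ?_
    obtain ⟨U, hU, hUeq⟩ := isOpen_induced_iff.mp (hopen f)
    have hmem (q : Ideal C(T, ℝ)) (hq : q ∈ minimalPrimes C(T, ℝ)) :
        (⟨q, hq.1.1⟩ : PrimeSpectrum C(T, ℝ)) ∈ U ↔ q ⊔ Ideal.span {f} ≠ ⊤ := by
      rw [← mem_downset_zeroLocus_iff f ⟨q, hq.1.1⟩]
      exact Set.ext_iff.mp hUeq ⟨⟨q, hq.1.1⟩, (mem_minPts_iff _).mpr hq⟩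
    obtain ⟨_, ⟨h, rfl⟩, hhp, hhU⟩ :=
      PrimeSpectrum.isTopologicalBasis_basic_opens.exists_subset_of_mem_open
        ((hmem p hp).mpr hpf) hU
    exact ⟨h, hhp, fun q hq hhq => (hmem q hq).mp (hhU hhq)⟩
end

section
/- Let A be a reduced commutative ring with unit and X = Spec A its prime spectrum. The following are equivalent: (i) A is a Baer ring, i.e. for every f ∈ A there is an idempotent e ∈ A with Ann(f) = eA, where Ann(f) = {g ∈ A : fg = 0}; (ii) for every f ∈ A the closure of the basic open set D(f) = {p ∈ X : f ∉ p} is open; (iii) there is a continuous retraction X → X^min of the inclusion of the set X^min of minimal prime ideals into X; (iv) the lattice qcop(X) of compact open subsets of X is a Stone algebra. -/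
open Set Topology

open PCF

namespace PrimeSpectrum

section CommRing

variable {A : Type*} [CommRing A]

lemma mem_minPts_iff {x : PrimeSpectrum A} :
    x ∈ minPts (inferInstance : TopologicalSpace (PrimeSpectrum A)) ↔ IsMin x := by
  have h : ∀ y, specLE (inferInstance : TopologicalSpace (PrimeSpectrum A)) y x ↔ y ≤ x :=
    fun y => (le_iff_mem_closure y x).symm
  simp only [minPts, Set.mem_ofPred_eq, h]
  exact ⟨fun hx y hy => (hx y hy).ge, fun hx y hy => le_antisymm hy (hx hy)⟩

lemma exists_isMin_le (x : PrimeSpectrum A) : ∃ y : PrimeSpectrum A, IsMin y ∧ y ≤ x := by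
  obtain ⟨p, hp, hpx⟩ := Ideal.exists_minimalPrimes_le (I := ⊥) (J := x.asIdeal) bot_le
  exact ⟨⟨p, hp.1.1⟩, isMin_iff.2 hp, hpx⟩

/-- A continuous retraction onto the minimal points sends each point to a generization,
and it is the only minimal generization of that point. -/
lemma retraction_eq_of_isMin_of_le
    {r : PrimeSpectrum A → minPts (inferInstance : TopologicalSpace (PrimeSpectrum A))}
    (hr : Continuous r)
    (hr' : ∀ y : minPts (inferInstance : TopologicalSpace (PrimeSpectrum A)),
      r (y : PrimeSpectrum A) = y)
    {x y : PrimeSpectrum A} (hy : IsMin y) (hyx : y ≤ x) : (r x : PrimeSpectrum A) = y := by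
  have h := ((le_iff_specializes y x).1 hyx).map (continuous_subtype_val.comp hr)
  have hy' : (r y : PrimeSpectrum A) = y := congrArg Subtype.val (hr' ⟨y, mem_minPts_iff.2 hy⟩)
  rw [Function.comp_apply, Function.comp_apply, hy', ← le_iff_specializes] at h
  exact le_antisymm (mem_minPts_iff.1 (r x).2 h) h

end CommRing

section IsReduced

variable {A : Type*} [CommRing A] [IsReduced A]

lemma mem_vanishingIdeal_basicOpen {f g : A} :
    g ∈ vanishingIdeal (basicOpen f : Set (PrimeSpectrum A)) ↔ f * g = 0 := by
  rw [mem_vanishingIdeal, ← isNilpotent_iff_eq_zero, ← mem_nilradical, nilradical_eq_sInf,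
    Ideal.mem_sInf]
  constructor
  · intro h I hI
    by_cases hf : f ∈ I
    · exact I.mul_mem_right g hf
    · exact I.mul_mem_left f (h ⟨I, hI⟩ hf)
  · intro h x hx
    exact (x.isPrime.mem_or_mem (h x.isPrime)).resolve_left hx

lemma mem_closure_basicOpen {f : A} {x : PrimeSpectrum A} :
    x ∈ closure (basicOpen f : Set (PrimeSpectrum A)) ↔ ∀ g, f * g = 0 → g ∈ x.asIdeal := by
  rw [← zeroLocus_vanishingIdeal_eq_closure]
  exact ⟨fun h g hg => h (mem_vanishingIdeal_basicOpen.2 hg),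
    fun h g hg => h g (mem_vanishingIdeal_basicOpen.1 hg)⟩

/-- In a reduced ring, every element of a minimal prime is annihilated by an element outside
that prime. -/
lemma exists_notMem_mul_eq_zero_of_isMin {x : PrimeSpectrum A} (hx : IsMin x) {f : A}
    (hf : f ∈ x.asIdeal) : ∃ g ∉ x.asIdeal, f * g = 0 := by
  have : Ring.KrullDimLE 0 (Localization.AtPrime x.asIdeal) :=
    .of_isLocalization _ (isMin_iff.1 hx) _
  let : Field (Localization.AtPrime x.asIdeal) := Ring.KrullDimLE.isField_of_isReduced.toField
  obtain ⟨⟨g, hg⟩, h⟩ := (IsLocalization.map_eq_zero_iff x.asIdeal.primeCompl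
    (Localization.AtPrime x.asIdeal) f).mp (by
      rw [← Ideal.mem_bot, ← IsLocalRing.maximalIdeal_eq_bot,
        ← Localization.AtPrime.map_eq_maximalIdeal]
      exact Ideal.mem_map_of_mem _ hf)
  exact ⟨g, hg, by rw [mul_comm]; exact h⟩

lemma mem_closure_basicOpen_iff_of_isMin {f : A} {x : PrimeSpectrum A} (hx : IsMin x) :
    x ∈ closure (basicOpen f : Set (PrimeSpectrum A)) ↔ f ∉ x.asIdeal := by
  refine ⟨fun h hf => ?_, fun hf => subset_closure hf⟩
  obtain ⟨g, hg, hfg⟩ := exists_notMem_mul_eq_zero_of_isMin hx hf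
  exact hg (mem_closure_basicOpen.1 h g hfg)

lemma isOpen_closure_basicOpen_iff {f : A} :
    IsOpen (closure (basicOpen f : Set (PrimeSpectrum A))) ↔
      ∃ e : A, IsIdempotentElem e ∧ ∀ g : A, f * g = 0 ↔ g ∈ Ideal.span ({e} : Set A) := by
  constructor
  · intro h
    obtain ⟨e, he, hs⟩ := isClopen_iff_zeroLocus.1 ⟨isClosed_closure, h⟩
    refine ⟨e, he, fun g => ?_⟩
    rw [← mem_vanishingIdeal_basicOpen, ← vanishingIdeal_closure, hs, ← zeroLocus_span,
      vanishingIdeal_zeroLocus_eq_radical]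
    refine ⟨?_, fun hg => Ideal.le_radical hg⟩
    rintro ⟨n, hn⟩
    obtain ⟨a, ha⟩ := Ideal.mem_span_singleton'.1 hn
    have h0 : ((1 - e) * g) ^ (n + 1) = 0 := by
      rw [pow_succ, mul_pow, ← ha]
      linear_combination (-(1 - e) ^ n * a * g) * he.eq
    have h1 := pow_eq_zero_iff (Nat.succ_ne_zero n) |>.1 h0
    exact Ideal.mem_span_singleton'.2 ⟨g, by linear_combination -h1⟩
  · rintro ⟨e, he, h⟩
    have hv : vanishingIdeal (basicOpen f : Set (PrimeSpectrum A)) = Ideal.span {e} := by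
      ext g
      rw [mem_vanishingIdeal_basicOpen, h]
    rw [← zeroLocus_vanishingIdeal_eq_closure, hv, zeroLocus_span]
    exact (isClopen_iff_zeroLocus.2 ⟨e, he, rfl⟩).isOpen

lemma mem_closure_basicOpen_iff_of_isMin_of_le {f : A}
    (h : IsOpen (closure (basicOpen f : Set (PrimeSpectrum A)))) {x y : PrimeSpectrum A}
    (hy : IsMin y) (hyx : y ≤ x) :
    x ∈ closure (basicOpen f : Set (PrimeSpectrum A)) ↔ f ∉ y.asIdeal := by
  have hs := (le_iff_specializes y x).1 hyx
  rw [← mem_closure_basicOpen_iff_of_isMin hy]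
  exact ⟨fun hx => hs.mem_open h hx, fun hy => hs.mem_closed isClosed_closure hy⟩

lemma exists_retraction_of_isOpen_closure_basicOpen
    (h : ∀ f : A, IsOpen (closure (basicOpen f : Set (PrimeSpectrum A)))) :
    ∃ r : PrimeSpectrum A → minPts (inferInstance : TopologicalSpace (PrimeSpectrum A)),
      Continuous r ∧
        ∀ y : minPts (inferInstance : TopologicalSpace (PrimeSpectrum A)),
          r (y : PrimeSpectrum A) = y := by
  choose m hm hle using exists_isMin_le (A := A)
  refine ⟨fun x => ⟨m x, mem_minPts_iff.2 (hm x)⟩, ?_, fun y => Subtype.ext ?_⟩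
  · refine Continuous.subtype_mk
      (isTopologicalBasis_basic_opens.continuous_iff.2 ?_) _
    rintro _ ⟨f, rfl⟩
    convert! h f using 1
    ext x
    exact (mem_closure_basicOpen_iff_of_isMin_of_le (h f) (hm x) (hle x)).symm
  · exact le_antisymm (hle y) (mem_minPts_iff.1 y.2 (hle y))

lemma isClopen_preimage_basicOpen_minPts (f : A) :
    IsClopen ((↑) ⁻¹' (basicOpen f : Set (PrimeSpectrum A)) :
      Set (minPts (inferInstance : TopologicalSpace (PrimeSpectrum A)))) := by
  refine ⟨?_, (basicOpen f).isOpen.preimage continuous_subtype_val⟩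
  convert! (isClosed_closure (s := (basicOpen f : Set (PrimeSpectrum A)))).preimage
    (continuous_subtype_val (p := (· ∈ minPts (inferInstance : TopologicalSpace
      (PrimeSpectrum A))))) using 1
  ext y
  exact (mem_closure_basicOpen_iff_of_isMin (mem_minPts_iff.1 y.2)).symm

lemma isOpen_closure_basicOpen_of_retraction
    {r : PrimeSpectrum A → minPts (inferInstance : TopologicalSpace (PrimeSpectrum A))}
    (hr : Continuous r)
    (hr' : ∀ y : minPts (inferInstance : TopologicalSpace (PrimeSpectrum A)),
      r (y : PrimeSpectrum A) = y) (f : A) :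
    IsOpen (closure (basicOpen f : Set (PrimeSpectrum A))) := by
  have hle : ∀ x, (r x : PrimeSpectrum A) ≤ x := fun x => by
    obtain ⟨y, hy, hyx⟩ := exists_isMin_le x
    exact (retraction_eq_of_isMin_of_le hr hr' hy hyx).trans_le hyx
  have hU := (isClopen_preimage_basicOpen_minPts f).preimage hr
  convert! hU.isOpen using 1
  have hsub : (basicOpen f : Set (PrimeSpectrum A)) ⊆
      r ⁻¹' ((↑) ⁻¹' (basicOpen f : Set (PrimeSpectrum A))) := fun x hx =>
    ((le_iff_specializes _ _).1 (hle x)).mem_open (basicOpen f).isOpen hx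
  refine (closure_minimal hsub hU.isClosed).antisymm fun x hx => ?_
  exact ((le_iff_specializes _ _).1 (hle x)).mem_closed isClosed_closure (subset_closure hx)

end IsReduced

section qcop

variable {A : Type*} [CommRing A]

lemma basicOpen_mem_qcop (f : A) :
    (basicOpen f : Set (PrimeSpectrum A)) ∈
      qcop (inferInstance : TopologicalSpace (PrimeSpectrum A)) :=
  ⟨(basicOpen f).isOpen, isCompact_basicOpen f⟩

lemma isClopen_closure_of_mem_qcop
    (h : ∀ f : A, IsOpen (closure (basicOpen f : Set (PrimeSpectrum A))))
    {U : Set (PrimeSpectrum A)}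
    (hU : U ∈ qcop (inferInstance : TopologicalSpace (PrimeSpectrum A))) :
    IsClopen (closure U) := by
  refine ⟨isClosed_closure, ?_⟩
  obtain ⟨s, hs, rfl⟩ := (isCompact_open_iff_eq_finite_iUnion_of_isTopologicalBasis _
    isTopologicalBasis_basic_opens isCompact_basicOpen U).1 ⟨hU.2, hU.1⟩
  rw [hs.closure_biUnion]
  exact isOpen_biUnion fun f _ => h f

lemma stoneAlgebra_qcop_of_isOpen_closure_basicOpen
    (h : ∀ f : A, IsOpen (closure (basicOpen f : Set (PrimeSpectrum A)))) :
    StoneAlgebra (qcop (inferInstance : TopologicalSpace (PrimeSpectrum A))) := by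
  have hc : ∀ U ∈ qcop (inferInstance : TopologicalSpace (PrimeSpectrum A)),
      IsPseudoCompl (qcop (inferInstance : TopologicalSpace (PrimeSpectrum A))) U
        (closure U)ᶜ := by
    intro U hU
    have hcl := (isClopen_closure_of_mem_qcop h hU).compl
    refine ⟨⟨hcl.isOpen, hcl.isClosed.isCompact⟩, ?_, fun W hW hUW => ?_⟩
    · exact (disjoint_compl_right.mono_left subset_closure).inter_eq
    · exact ((Set.disjoint_iff_inter_eq_empty.2 hUW).closure_left hW.1).subset_compl_left
  refine ⟨fun U hU => ⟨_, hc U hU⟩, fun U hU V W hV hW => ?_⟩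
  have hcl := isClopen_closure_of_mem_qcop h hU
  obtain rfl : V = (closure U)ᶜ :=
    ((hc U hU).2.2 V hV.1 hV.2.1).antisymm (hV.2.2 _ (hc U hU).1 (hc U hU).2.1)
  have hW' : closure U ⊆ W :=
    hW.2.2 _ ⟨hcl.isOpen, hcl.isClosed.isCompact⟩ (Set.compl_inter_self _)
  exact Set.eq_univ_of_subset (Set.union_subset_union_right _ hW') (Set.compl_union_self _)

lemma isOpen_closure_basicOpen_of_stoneAlgebra
    (h : StoneAlgebra (qcop (inferInstance : TopologicalSpace (PrimeSpectrum A)))) (f : A) :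
    IsOpen (closure (basicOpen f : Set (PrimeSpectrum A))) := by
  obtain ⟨V, hV⟩ := h.1 _ (basicOpen_mem_qcop f)
  obtain ⟨W, hW⟩ := h.1 V hV.1
  have hVW : Vᶜ = W := IsCompl.compl_eq ⟨Set.disjoint_iff_inter_eq_empty.2 hW.2.1,
    codisjoint_iff.2 (h.2 _ (basicOpen_mem_qcop f) V W hV hW)⟩
  suffices closure (basicOpen f : Set (PrimeSpectrum A)) = Vᶜ by
    rw [this, hVW]
    exact hW.1.1
  refine (closure_minimal (Set.disjoint_iff_inter_eq_empty.2 hV.2.1).subset_compl_right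
    hV.1.1.isClosed_compl).antisymm fun x hx => ?_
  by_contra hxc
  obtain ⟨_, ⟨g, rfl⟩, hxg, hg⟩ := isTopologicalBasis_basic_opens.exists_subset_of_mem_open
    hxc isClosed_closure.isOpen_compl
  refine hx (hV.2.2 _ (basicOpen_mem_qcop g) ?_ hxg)
  exact Set.disjoint_iff_inter_eq_empty.1
    (disjoint_compl_right.mono subset_closure hg)

end qcop

end PrimeSpectrum

/-- For a reduced commutative ring `A` with `X = Spec A`, TFAE:
(i) `A` is a Baer ring: the annihilator of every element is generated by an idempotent;
(ii) the closure of every basic open set `D(f)` is open; (iii) there is a continuous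
retraction of `X` onto the subspace `X^min` of minimal primes; (iv) `qcop X` is a
Stone algebra. -/
theorem statement_19 {A : Type*} [CommRing A] [IsReduced A] :
    List.TFAE
      [ ∀ f : A, ∃ e : A, IsIdempotentElem e ∧
          ∀ g : A, f * g = 0 ↔ g ∈ Ideal.span ({e} : Set A),
        ∀ f : A, IsOpen (closure (PrimeSpectrum.basicOpen f : Set (PrimeSpectrum A))),
        ∃ r : PrimeSpectrum A →
            minPts (inferInstance : TopologicalSpace (PrimeSpectrum A)),
          Continuous r ∧
            ∀ y : minPts (inferInstance : TopologicalSpace (PrimeSpectrum A)),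
              r (y : PrimeSpectrum A) = y,
        StoneAlgebra (qcop (inferInstance : TopologicalSpace (PrimeSpectrum A))) ] := by
  tfae_have 1 ↔ 2 := forall_congr' fun f => PrimeSpectrum.isOpen_closure_basicOpen_iff.symm
  tfae_have 2 → 3 := PrimeSpectrum.exists_retraction_of_isOpen_closure_basicOpen
  tfae_have 3 → 2 := fun ⟨_, hr, hr'⟩ =>
    PrimeSpectrum.isOpen_closure_basicOpen_of_retraction hr hr'
  tfae_have 2 → 4 := PrimeSpectrum.stoneAlgebra_qcop_of_isOpen_closure_basicOpen
  tfae_have 4 → 2 := PrimeSpectrum.isOpen_closure_basicOpen_of_stoneAlgebra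
  tfae_finish
end
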